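/- The incidence function h : ℝ⁴ → ℝ defined by h(s,e,i,r) = s·i/(s+e+i+r) when s+e+i+r > 0 and h(s,e,i,r) = 0 when s+e+i+r = 0 is Lipschitz continuous on the nonnegative orthant {(s,e,i,r) ∈ ℝ⁴ : s ≥ 0, e ≥ 0, i ≥ 0, r ≥ 0}; i.e., there exists K ≥ 0 such that |h(v) − h(w)| ≤ K‖v − w‖ for all v, w in the nonnegative orthant. -/

import Mathlib

/-- The standard-incidence function of the SEIRS model:
`h (s,e,i,r) = s·i/(s+e+i+r)` when `s+e+i+r > 0`, and `0` when the sum is not positive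
(in particular when it equals `0`). -/
noncomputable def seirsIncidence (v : ℝ × ℝ × ℝ × ℝ) : ℝ :=
  if 0 < v.1 + v.2.1 + v.2.2.1 + v.2.2.2 then
    v.1 * v.2.2.1 / (v.1 + v.2.1 + v.2.2.1 + v.2.2.2)
  else 0

theorem seirs_aux (v : ℝ × ℝ × ℝ × ℝ)
    (hv : 0 ≤ v.1 ∧ 0 ≤ v.2.1 ∧ 0 ≤ v.2.2.1 ∧ 0 ≤ v.2.2.2) :
    ∃ p q : ℝ, |p| ≤ 1 ∧ |q| ≤ 1 ∧ seirsIncidence v = p * v.1 ∧ seirsIncidence v = q * v.2.2.1 ∧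
      v.2.2.1 = p * (v.1 + v.2.1 + v.2.2.1 + v.2.2.2) ∧
      v.1 = q * (v.1 + v.2.1 + v.2.2.1 + v.2.2.2) := by
  obtain ⟨s, e, i, r⟩ := v
  obtain ⟨h1, h2, h3, h4⟩ := hv
  simp only [seirsIncidence] at *
  split_ifs with h
  · refine ⟨i / (s + e + i + r), s / (s + e + i + r), ?_, ?_, ?_, ?_, ?_, ?_⟩
    · rw [abs_of_nonneg (by positivity), div_le_one h]; linarith
    · rw [abs_of_nonneg (by positivity), div_le_one h]; linarith
    all_goals field_simp
  · refine ⟨0, 0, by simp, by simp, by simp, by simp, ?_, ?_⟩ <;> linarith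

/-- The incidence function `h(s,e,i,r) = s·i/(s+e+i+r)` (set to `0` when `s+e+i+r = 0`)
is Lipschitz continuous on the nonnegative orthant of `ℝ⁴`. -/
theorem seirsIncidence_lipschitzOn_nonneg_orthant :
    ∃ K : ℝ, 0 ≤ K ∧ ∀ v w : ℝ × ℝ × ℝ × ℝ,
      (0 ≤ v.1 ∧ 0 ≤ v.2.1 ∧ 0 ≤ v.2.2.1 ∧ 0 ≤ v.2.2.2) →
      (0 ≤ w.1 ∧ 0 ≤ w.2.1 ∧ 0 ≤ w.2.2.1 ∧ 0 ≤ w.2.2.2) →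
      |seirsIncidence v - seirsIncidence w| ≤ K * ‖v - w‖ := by
  refine ⟨6, by norm_num, fun v w hv hw => ?_⟩
  obtain ⟨p, -, hp, -, hvp, -, hip, -⟩ := seirs_aux v hv
  obtain ⟨-, q, -, hq, -, hwq, -, hsq⟩ := seirs_aux w hw
  rw [hvp, hwq]
  have n1 : |v.1 - w.1| ≤ ‖v - w‖ := norm_fst_le (v - w)
  have n2' : ‖(v - w).2‖ ≤ ‖v - w‖ := norm_snd_le (v - w)
  have n2 : |v.2.1 - w.2.1| ≤ ‖v - w‖ := (norm_fst_le (v - w).2).trans n2'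
  have n3' : ‖(v - w).2.2‖ ≤ ‖v - w‖ := (norm_snd_le (v - w).2).trans n2'
  have n3 : |v.2.2.1 - w.2.2.1| ≤ ‖v - w‖ := (norm_fst_le (v - w).2.2).trans n3'
  have n4 : |v.2.2.2 - w.2.2.2| ≤ ‖v - w‖ := (norm_snd_le (v - w).2.2).trans n3'
  generalize ‖v - w‖ = D at *
  clear n2' n3'
  obtain ⟨s, e, i, r⟩ := v
  obtain ⟨s', e', i', r'⟩ := w
  simp only at *
  have key : p * s - q * i' = p * (s - s') + (q * p) * ((s' + e' + i' + r') - (s + e + i + r))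
      + q * (i - i') := by
    linear_combination p * hsq - q * hip
  have n5 : |(s' + e' + i' + r') - (s + e + i + r)| ≤ 4 * D := by
    rw [abs_le] at *
    constructor <;> linarith
  have hb : ∀ a x B : ℝ, |a| ≤ 1 → |x| ≤ B → |a * x| ≤ B := fun a x B ha hx => by
    rw [abs_mul]
    nlinarith [abs_nonneg a, abs_nonneg x]
  have b1 := hb _ _ _ hp n1
  have b2 := hb _ _ _ (hb _ _ _ hq hp) n5
  have b3 := hb _ _ _ hq n3
  rw [key]
  have t1 := abs_add_le (p * (s - s') + (q * p) * ((s' + e' + i' + r') - (s + e + i + r))) (q * (i - i'))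
  have t2 := abs_add_le (p * (s - s')) ((q * p) * ((s' + e' + i' + r') - (s + e + i + r)))
  linarith
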